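/- Truth Lemma for the canonical model of PCL: for every formula F of conditional logic and every world (X,A) of the canonical model, F ∈ X if and only if (X,A) forces F in the canonical model. -/

import Mathlib

/-- Formulas of conditional logic. -/
inductive Formula : Type
  | atom : ℕ → Formula
  | bot : Formula
  | and : Formula → Formula → Formula
  | or : Formula → Formula → Formula
  | imp : Formula → Formula → Formula
  | cond : Formula → Formula → Formula

namespace Formula

/-- ¬A abbreviates A → ⊥. -/
def neg (A : Formula) : Formula := A.imp Formula.bot

/-- ⊤ abbreviates ⊥ → ⊥. -/
def top : Formula := Formula.bot.imp Formula.bot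

/-- A ↔ B abbreviates (A → B) ∧ (B → A). -/
def biimp (A B : Formula) : Formula := (A.imp B).and (B.imp A)

/-- Boolean evaluation of a formula, where atoms are evaluated via `v` and
conditional subformulas are treated as atoms evaluated via `w`. -/
def beval (v : ℕ → Bool) (w : Formula → Formula → Bool) : Formula → Bool
  | atom p => v p
  | bot => false
  | and A B => beval v w A && beval v w B
  | or A B => beval v w A || beval v w B
  | imp A B => !(beval v w A) || beval v w B
  | cond A B => w A B

/-- Classical propositional tautology (conditional subformulas treated as atoms). -/
def Tautology (F : Formula) : Prop := ∀ v w, beval v w F = true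

end Formula

open Formula

/-- Hilbert-style derivability: classical tautologies, modus ponens,
(RCEA), (RCK), (ID), (R-And), (CM), (OR), plus extra axioms from `Ax`. -/
inductive Deriv (Ax : Set Formula) : Formula → Prop
  | taut {F : Formula} : Tautology F → Deriv Ax F
  | extra {F : Formula} : F ∈ Ax → Deriv Ax F
  | mp {A B : Formula} : Deriv Ax (A.imp B) → Deriv Ax A → Deriv Ax B
  | rcea {A B C : Formula} : Deriv Ax (A.biimp B) →
      Deriv Ax ((A.cond C).biimp (B.cond C))
  | rck {A B C : Formula} : Deriv Ax (A.imp B) → Deriv Ax ((C.cond A).imp (C.cond B))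
  | id {A : Formula} : Deriv Ax (A.cond A)
  | rAnd {A B C : Formula} : Deriv Ax (((A.cond B).and (A.cond C)).imp (A.cond (B.and C)))
  | cm {A B C : Formula} : Deriv Ax (((A.cond B).and (A.cond C)).imp ((A.and B).cond C))
  | or {A B C : Formula} : Deriv Ax (((A.cond C).and (B.cond C)).imp ((A.or B).cond C))

/-- Derivability in the basic preferential conditional logic PCL. -/
def PCL : Formula → Prop := Deriv ∅

/-- Forcing of a formula at a world, for raw neighbourhood data. -/
def Force {W : Type} (N : W → Set (Set W)) (val : ℕ → Set W) : Formula → W → Prop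
  | Formula.atom p, x => x ∈ val p
  | Formula.bot, _ => False
  | Formula.and A B, x => Force N val A x ∧ Force N val B x
  | Formula.or A B, x => Force N val A x ∨ Force N val B x
  | Formula.imp A B, x => Force N val A x → Force N val B x
  | Formula.cond A B, x => ∀ α ∈ N x, (∃ y ∈ α, Force N val A y) →
      ∃ β ∈ N x, β ⊆ α ∧ (∃ y ∈ β, Force N val A y) ∧
        ∀ y ∈ β, (Force N val A y → Force N val B y)

/-- A neighbourhood model. -/
structure NbhdModel where
  W : Type
  wNonempty : Nonempty W
  N : W → Set (Set W)
  val : ℕ → Set W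
  nbhdNonempty : ∀ x : W, ∀ α ∈ N x, α.Nonempty

/-- Forcing in a neighbourhood model. -/
def NbhdModel.force (M : NbhdModel) : Formula → M.W → Prop := Force M.N M.val

/-- Validity in the class of all neighbourhood models. -/
def ValidAll (F : Formula) : Prop := ∀ (M : NbhdModel) (x : M.W), M.force F x

/-- Total reflexivity. -/
def NbhdModel.TotallyReflexive (M : NbhdModel) : Prop :=
  ∀ x : M.W, ∃ α ∈ M.N x, x ∈ α

/-- Weak centering. -/
def NbhdModel.WeaklyCentered (M : NbhdModel) : Prop :=
  ∀ x : M.W, ∀ α ∈ M.N x, x ∈ α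

/-- Centering. -/
def NbhdModel.Centered (M : NbhdModel) : Prop :=
  (∀ x : M.W, ∀ α ∈ M.N x, x ∈ α) ∧ ∀ x : M.W, {x} ∈ M.N x

/-- Uniformity. -/
def NbhdModel.Uniform (M : NbhdModel) : Prop :=
  ∀ x y : M.W, (∃ α ∈ M.N x, y ∈ α) → ⋃₀ M.N x = ⋃₀ M.N y

/-- Absoluteness. -/
def NbhdModel.Absolute (M : NbhdModel) : Prop :=
  ∀ x y : M.W, ∀ α ∈ M.N x, y ∈ α → M.N x = M.N y

/-- Conjunction of a list of formulas. -/
def conj : List Formula → Formula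
  | [] => Formula.top
  | A :: l => A.and (conj l)

/-- A set of formulas is inconsistent if some nonempty finite list of its members
has a PCL-provably contradictory conjunction. -/
def Inconsistent (S : Set Formula) : Prop :=
  ∃ L : List Formula, L ≠ [] ∧ (∀ B ∈ L, B ∈ S) ∧ PCL ((conj L).imp Formula.bot)

def Consistent (S : Set Formula) : Prop := ¬ Inconsistent S

/-- Maximal consistent set. -/
def MaxConsistent (S : Set Formula) : Prop :=
  Consistent S ∧ ∀ A ∉ S, Inconsistent (insert A S)

/-- Set of conditional consequences X^B = {C : B > C ∈ X}. -/
def condCons (X : Set Formula) (B : Formula) : Set Formula := {C | B.cond C ∈ X}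

/-- A ≤_X B iff (A ∨ B) > A ∈ X. -/
def cleq (X : Set Formula) (A B : Formula) : Prop := (A.or B).cond A ∈ X

/-- Worlds of the canonical model: pairs (X, A) with X maximal consistent, A ∈ X. -/
def CanonWorld : Type :=
  {p : Set Formula × Formula // MaxConsistent p.1 ∧ p.2 ∈ p.1}

/-- Canonical neighbourhood α^X_{(Y,B)}. -/
def sphere (X : Set Formula) (Y : CanonWorld) : Set CanonWorld :=
  {Z | condCons X Z.val.2 ⊆ Z.val.1 ∧ cleq X Z.val.2 Y.val.2 ∧ Y.val.2 ∉ Z.val.1}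
    ∪ {Y}

/-- Canonical neighbourhood function 𝒩(X,A). -/
def canonN (x : CanonWorld) : Set (Set CanonWorld) :=
  {α | ∃ Y : CanonWorld, condCons x.val.1 Y.val.2 ⊆ Y.val.1 ∧ α = sphere x.val.1 Y}

/-- Canonical valuation. -/
def canonVal (p : ℕ) : Set CanonWorld := {w | Formula.atom p ∈ w.val.1}

/-- Axiom (N). -/
def axN : Formula := (Formula.top.cond Formula.bot).neg
/-- Axiom schema (T). -/
def axT : Set Formula := {F | ∃ A : Formula, F = A.imp (A.cond Formula.bot).neg}
/-- Axiom schema (W). -/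
def axW : Set Formula := {F | ∃ A B : Formula, F = (A.cond B).imp (A.imp B)}
/-- Axiom schema (C). -/
def axC : Set Formula := {F | ∃ A B : Formula, F = (A.and B).imp (A.cond B)}
/-- Axiom schema (U1). -/
def axU1 : Set Formula :=
  {F | ∃ A : Formula,
    F = (A.neg.cond Formula.bot).imp ((A.neg.cond Formula.bot).neg.cond Formula.bot)}
/-- Axiom schema (U2). -/
def axU2 : Set Formula :=
  {F | ∃ A : Formula,
    F = (A.cond Formula.bot).neg.imp ((A.cond Formula.bot).cond Formula.bot)}


theorem beval_conj (v : ℕ → Bool) (w : Formula → Formula → Bool) (L : List Formula) :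
    beval v w (conj L) = true ↔ ∀ B ∈ L, beval v w B = true := by
  induction L with
  | nil => simp [conj, Formula.top, beval]
  | cons a l ih => simp [conj, beval, ih]

theorem beval_imp (v : ℕ → Bool) (w : Formula → Formula → Bool) (A B : Formula) :
    beval v w (A.imp B) = true ↔ (beval v w A = true → beval v w B = true) := by
  simp only [beval]
  cases beval v w A <;> simp

theorem beval_and (v : ℕ → Bool) (w : Formula → Formula → Bool) (A B : Formula) :
    beval v w (A.and B) = true ↔ (beval v w A = true ∧ beval v w B = true) := by
  simp [beval]

theorem beval_or (v : ℕ → Bool) (w : Formula → Formula → Bool) (A B : Formula) :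
    beval v w (A.or B) = true ↔ (beval v w A = true ∨ beval v w B = true) := by
  simp [beval]

theorem beval_bot (v : ℕ → Bool) (w : Formula → Formula → Bool) :
    beval v w Formula.bot = true ↔ False := by
  simp [beval]

/-- Tautological consequence of two theorems. -/
theorem pcl_mp2 {A B C : Formula} (h : Tautology (A.imp (B.imp C))) (ha : PCL A) (hb : PCL B) :
    PCL C := Deriv.mp (Deriv.mp (Deriv.taut h) ha) hb

/-- Provability from a set of assumptions. -/
def Prv (S : Set Formula) (F : Formula) : Prop :=
  ∃ L : List Formula, (∀ B ∈ L, B ∈ S) ∧ PCL ((conj L).imp F)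

theorem Prv.mem {S : Set Formula} {F : Formula} (h : F ∈ S) : Prv S F := by
  refine ⟨[F], by simpa using h, Deriv.taut ?_⟩
  intro v w
  simp only [beval_imp, beval_conj]
  intro h; exact h F (by simp)

theorem Prv.thm {S : Set Formula} {F : Formula} (h : PCL F) : Prv S F := by
  refine ⟨[], by simp, Deriv.mp (Deriv.taut ?_) h⟩
  intro v w
  simp only [beval_imp]
  tauto

theorem Prv.mp {S : Set Formula} {A B : Formula} (h : Prv S (A.imp B)) (h' : Prv S A) :
    Prv S B := by
  obtain ⟨L, hL, hp⟩ := h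
  obtain ⟨L', hL', hp'⟩ := h'
  refine ⟨L ++ L', ?_, pcl_mp2 ?_ hp hp'⟩
  · intro C hC
    rcases List.mem_append.1 hC with h | h
    · exact hL C h
    · exact hL' C h
  · intro v w
    simp only [beval_imp, beval_conj, List.mem_append]
    intro h1 h2 h3
    exact h1 (fun C hC => h3 C (Or.inl hC)) (h2 (fun C hC => h3 C (Or.inr hC)))

theorem Prv.conj {S : Set Formula} (L : List Formula) (h : ∀ B ∈ L, Prv S B) :
    Prv S (conj L) := by
  induction L with
  | nil => exact Prv.thm (Deriv.taut (by intro v w; simp [beval_conj]))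
  | cons a l ih =>
    have h1 := ih (fun B hB => h B (by simp [hB]))
    have h2 := h a (by simp)
    refine Prv.mp (Prv.mp (Prv.thm (Deriv.taut ?_)) h2) h1
    intro v w
    simp only [beval_imp, _root_.conj, beval_and]
    tauto

theorem Prv.cut {S T : Set Formula} {F : Formula} (h : Prv S F) (hT : ∀ B ∈ S, Prv T B) :
    Prv T F := by
  obtain ⟨L, hL, hp⟩ := h
  exact Prv.mp (Prv.thm hp) (Prv.conj L (fun B hB => hT B (hL B hB)))

theorem Prv.ded {S : Set Formula} {A F : Formula} (h : Prv (insert A S) F) :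
    Prv S (A.imp F) := by
  obtain ⟨L, hL, hp⟩ := h
  classical
  refine ⟨L.filter (fun B => decide (B ≠ A)), ?_, Deriv.mp (Deriv.taut ?_) hp⟩
  · intro B hB
    simp only [List.mem_filter, decide_eq_true_eq] at hB
    exact (hL B hB.1).resolve_left hB.2
  · intro v w
    simp only [beval_imp, beval_conj, List.mem_filter, decide_eq_true_eq]
    intro h1 h2 h3
    refine h1 (fun B hB => ?_)
    by_cases hBA : B = A
    · exact hBA ▸ h3
    · exact h2 B ⟨hB, hBA⟩

theorem inconsistent_iff {S : Set Formula} (hS : S.Nonempty) :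
    Inconsistent S ↔ Prv S Formula.bot := by
  constructor
  · rintro ⟨L, _, h, hp⟩
    exact ⟨L, h, hp⟩
  · rintro ⟨L, h, hp⟩
    obtain ⟨A, hA⟩ := hS
    refine ⟨A :: L, by simp, ?_, Deriv.mp (Deriv.taut ?_) hp⟩
    · intro B hB
      rcases List.mem_cons.1 hB with rfl | hB
      · exact hA
      · exact h B hB
    · intro v w
      simp only [beval_imp, conj, beval_and]
      tauto

/-- Nonempty maximal consistent sets. -/
def Mcs (X : Set Formula) : Prop := MaxConsistent X ∧ X.Nonempty

namespace Mcs

variable {X : Set Formula} (hX : Mcs X)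

theorem not_bot (hX : Mcs X) : ¬ Prv X Formula.bot := fun h =>
  hX.1.1 ((inconsistent_iff hX.2).2 h)

theorem closed (hX : Mcs X) {F : Formula} (h : Prv X F) : F ∈ X := by
  by_contra hF
  have h1 := (inconsistent_iff (Set.insert_nonempty _ _)).1 (hX.1.2 F hF)
  exact hX.not_bot (Prv.mp h1.ded h)

theorem thm (hX : Mcs X) {F : Formula} (h : PCL F) : F ∈ X := hX.closed (Prv.thm h)

theorem mp (hX : Mcs X) {A B : Formula} (h : A.imp B ∈ X) (h' : A ∈ X) : B ∈ X :=
  hX.closed (Prv.mp (Prv.mem h) (Prv.mem h'))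

theorem mp' (hX : Mcs X) {A B : Formula} (h : PCL (A.imp B)) (h' : A ∈ X) : B ∈ X :=
  hX.mp (hX.thm h) h'

theorem bot_mem (hX : Mcs X) : Formula.bot ∉ X := fun h => hX.not_bot (Prv.mem h)

theorem and_iff (hX : Mcs X) {A B : Formula} : A.and B ∈ X ↔ A ∈ X ∧ B ∈ X := by
  constructor
  · intro h
    constructor
    · refine hX.mp' (Deriv.taut ?_) h
      intro v w; simp only [beval_imp, beval_and]; tauto
    · refine hX.mp' (Deriv.taut ?_) h
      intro v w; simp only [beval_imp, beval_and]; tauto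
  · rintro ⟨h, h'⟩
    refine hX.mp (hX.mp' (Deriv.taut ?_) h) h'
    intro v w; simp only [beval_imp, beval_and]; tauto

theorem imp_iff (hX : Mcs X) {A B : Formula} : A.imp B ∈ X ↔ (A ∈ X → B ∈ X) := by
  constructor
  · exact fun h h' => hX.mp h h'
  · intro h
    by_cases hA : A ∈ X
    · refine hX.mp' (Deriv.taut ?_) (h hA)
      intro v w; simp only [beval_imp]; tauto
    · have h1 := (inconsistent_iff (Set.insert_nonempty _ _)).1 (hX.1.2 A hA)
      refine hX.mp' (Deriv.taut ?_) (hX.closed h1.ded)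
      intro v w; simp only [beval_imp, beval_bot]; tauto

theorem or_iff (hX : Mcs X) {A B : Formula} : A.or B ∈ X ↔ A ∈ X ∨ B ∈ X := by
  constructor
  · intro h
    by_contra hn
    push Not at hn
    have h1 : A.imp Formula.bot ∈ X := hX.imp_iff.2 (fun h => absurd h hn.1)
    have h2 : (A.imp Formula.bot).imp B ∈ X := by
      refine hX.mp' (Deriv.taut ?_) h
      intro v w; simp only [beval_imp, beval_or, beval_bot]; tauto
    exact hn.2 (hX.mp h2 h1)
  · rintro (h | h)
    · refine hX.mp' (Deriv.taut ?_) h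
      intro v w; simp only [beval_imp, beval_or]; tauto
    · refine hX.mp' (Deriv.taut ?_) h
      intro v w; simp only [beval_imp, beval_or]; tauto

theorem c_mono (hX : Mcs X) {A B C : Formula} (h : A.cond B ∈ X) (ht : Tautology (B.imp C)) :
    A.cond C ∈ X := hX.mp' (Deriv.rck (Deriv.taut ht)) h

theorem c_eq (hX : Mcs X) {A B C : Formula} (h : A.cond C ∈ X) (ht : Tautology (A.biimp B)) :
    B.cond C ∈ X := hX.mp (hX.and_iff.1 (hX.thm (Deriv.rcea (Deriv.taut ht)))).1 h

theorem c_id (hX : Mcs X) (A : Formula) : A.cond A ∈ X := hX.thm Deriv.id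

theorem c_and (hX : Mcs X) {A B C : Formula} (h : A.cond B ∈ X) (h' : A.cond C ∈ X) :
    A.cond (B.and C) ∈ X := hX.mp' Deriv.rAnd (hX.and_iff.2 ⟨h, h'⟩)

theorem c_cm (hX : Mcs X) {A B C : Formula} (h : A.cond B ∈ X) (h' : A.cond C ∈ X) :
    (A.and B).cond C ∈ X := hX.mp' Deriv.cm (hX.and_iff.2 ⟨h, h'⟩)

theorem c_or (hX : Mcs X) {A B C : Formula} (h : A.cond C ∈ X) (h' : B.cond C ∈ X) :
    (A.or B).cond C ∈ X := hX.mp' Deriv.or (hX.and_iff.2 ⟨h, h'⟩)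

/-- If `A > B` then `(D ∨ A) > (A → B)`. -/
theorem c_weak (hX : Mcs X) {A B : Formula} (D : Formula) (h : A.cond B ∈ X) :
    (D.or A).cond (A.imp B) ∈ X := by
  have h1 : A.cond (A.imp B) ∈ X := hX.c_mono h (by
    intro v w; simp only [beval_imp]; tauto)
  have h2 : (D.and (A.imp Formula.bot)).cond (A.imp B) ∈ X :=
    hX.c_mono (hX.c_id _) (by
      intro v w; simp only [beval_imp, beval_and, beval_bot]; tauto)
  refine hX.c_eq (hX.c_or h2 h1) ?_
  intro v w; simp only [biimp, beval_imp, beval_and, beval_or, beval_bot]; tauto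

theorem three (hX : Mcs X) {D C B : Formula} (h1 : cleq X D C) (h2 : cleq X C B) :
    (D.or (C.or B)).cond D ∈ X := by
  unfold cleq at h1 h2
  have e1 : (D.or (C.or B)).cond (D.or C) ∈ X := by
    refine hX.c_or (hX.c_mono (hX.c_id _) ?_) (hX.c_mono h2 ?_)
    · intro v w; simp only [beval_imp, beval_or]; tauto
    · intro v w; simp only [beval_imp, beval_or]; tauto
  have e2 : (D.or (C.or B)).cond ((D.or C).imp D) ∈ X := by
    refine hX.c_eq (hX.c_weak B h1) ?_
    intro v w; simp only [biimp, beval_imp, beval_and, beval_or]; tauto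
  refine hX.c_mono (hX.c_and e1 e2) ?_
  intro v w; simp only [beval_imp, beval_and, beval_or]; tauto

theorem cleq_trans (hX : Mcs X) {D C B : Formula} (h1 : cleq X D C) (h2 : cleq X C B) :
    cleq X D B := by
  have e := hX.three h1 h2
  have e1 : (D.or (C.or B)).cond (D.or B) ∈ X := hX.c_mono e (by
    intro v w; simp only [beval_imp, beval_or]; tauto)
  refine hX.c_eq (hX.c_cm e1 e) ?_
  intro v w; simp only [biimp, beval_imp, beval_and, beval_or]; tauto

theorem normal_not_mem (hX : Mcs X) {V : Set Formula} (hV : Mcs V) {D C B : Formula}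
    (h1 : cleq X D C) (h2 : cleq X C B) (hn : condCons X D ⊆ V) (hC : C ∉ V) : B ∉ V := by
  have e := hX.three h1 h2
  have e1 : (D.or (C.or B)).cond ((C.or B).imp C) ∈ X := hX.c_weak D h2
  have e2 : D.cond ((C.or B).imp C) ∈ X := by
    refine hX.c_eq (hX.c_cm e e1) ?_
    intro v w; simp only [biimp, beval_imp, beval_and, beval_or]; tauto
  intro hB
  exact hC (hV.mp (hn e2) (hV.or_iff.2 (Or.inr hB)))

theorem min_sat (hX : Mcs X) {V : Set Formula} (hV : Mcs V) {A B C : Formula}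
    (h : A.cond B ∈ X) (hle : cleq X C A) (hn : condCons X C ⊆ V) (hA : A ∈ V) : B ∈ V := by
  have e1 := hX.c_weak C h
  have e2 : C.cond (A.imp B) ∈ X := by
    refine hX.c_eq (hX.c_cm hle e1) ?_
    intro v w; simp only [biimp, beval_imp, beval_and, beval_or]; tauto
  exact hV.mp (hn e2) hA

end Mcs

theorem lindenbaum {S : Set Formula} (hS : Consistent S) : ∃ X, S ⊆ X ∧ MaxConsistent X := by
  obtain ⟨M, hSM, hM⟩ := zorn_subset_nonempty {T : Set Formula | Consistent T} (by
    intro c hc hchain hne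
    refine ⟨⋃₀ c, ?_, fun s hs => Set.subset_sUnion_of_mem hs⟩
    rintro ⟨L, hL0, hL, hp⟩
    have key : ∀ L : List Formula, (∀ B ∈ L, B ∈ ⋃₀ c) → ∃ T ∈ c, ∀ B ∈ L, B ∈ T := by
      intro L
      induction L with
      | nil => intro _; obtain ⟨T, hT⟩ := hne; exact ⟨T, hT, by simp⟩
      | cons a l ih =>
        intro h
        obtain ⟨T, hT, h1⟩ := ih (fun B hB => h B (by simp [hB]))
        obtain ⟨T', hT', h2⟩ := h a (by simp)
        rcases hchain.total hT hT' with hh | hh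
        · refine ⟨T', hT', ?_⟩
          intro B hB
          rcases List.mem_cons.1 hB with rfl | hB
          · exact h2
          · exact hh (h1 B hB)
        · refine ⟨T, hT, ?_⟩
          intro B hB
          rcases List.mem_cons.1 hB with rfl | hB
          · exact hh h2
          · exact h1 B hB
    obtain ⟨T, hT, h⟩ := key L hL
    exact hc hT ⟨L, hL0, h, hp⟩) S hS
  refine ⟨M, hSM, hM.1, ?_⟩
  intro A hA
  by_contra hcon
  exact hA (hM.2 (y := insert A M) hcon (Set.subset_insert A M) (Set.mem_insert A M))

theorem Mcs.prv_cond {X : Set Formula} (hX : Mcs X) {A F : Formula}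
    (h : Prv (condCons X A) F) : A.cond F ∈ X := by
  obtain ⟨L, hL, hp⟩ := h
  have key : ∀ L : List Formula, (∀ B ∈ L, B ∈ condCons X A) → A.cond (conj L) ∈ X := by
    intro L
    induction L with
    | nil =>
      intro _
      exact hX.c_mono (hX.c_id A) (by intro v w; simp [beval_imp, beval_conj])
    | cons a l ih =>
      intro h
      exact hX.c_and (h a (by simp)) (ih (fun B hB => h B (by simp [hB])))
  exact hX.mp' (Deriv.rck hp) (key L hL)

/-- If `A > F ∉ X` there is a maximal consistent set extending `X^A` without `F`. -/
theorem Mcs.exists_ext {X : Set Formula} (hX : Mcs X) {A F : Formula} (h : A.cond F ∉ X) :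
    ∃ Y, Mcs Y ∧ condCons X A ⊆ Y ∧ A ∈ Y ∧ F ∉ Y := by
  have hc : Consistent (insert (F.imp Formula.bot) (condCons X A)) := by
    intro hi
    have h1 := ((inconsistent_iff (Set.insert_nonempty _ _)).1 hi).ded
    apply h
    refine hX.prv_cond (Prv.mp (Prv.thm (Deriv.taut ?_)) h1)
    intro v w; simp only [beval_imp, beval_bot]; tauto
  obtain ⟨Y, hY, hm⟩ := lindenbaum hc
  have hY' : Mcs Y := ⟨hm, (Set.insert_nonempty _ _).mono hY⟩
  have hs : condCons X A ⊆ Y := (Set.subset_insert _ _).trans hY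
  refine ⟨Y, hY', hs, hs (hX.c_id A), ?_⟩
  intro hF
  exact hY'.bot_mem (hY'.mp (hY (Set.mem_insert _ _)) hF)

theorem CanonWorld.mcs (w : CanonWorld) : Mcs w.val.1 := ⟨w.2.1, ⟨_, w.2.2⟩⟩

theorem sphere_subset {X : Set Formula} (hX : Mcs X) {Y Z : CanonWorld} (h : Z ∈ sphere X Y) :
    sphere X Z ⊆ sphere X Y := by
  intro V hV
  rcases hV with ⟨v1, v2, v3⟩ | hV
  · rcases h with ⟨z1, z2, z3⟩ | h
    · exact Or.inl ⟨v1, hX.cleq_trans v2 z2, hX.normal_not_mem V.mcs v2 z2 v1 v3⟩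
    · obtain rfl : Z = Y := h
      exact Or.inl ⟨v1, v2, v3⟩
  · obtain rfl : V = Z := hV
    exact h

theorem min_unique {X : Set Formula} (hX : Mcs X) {A : Formula} {Z V : CanonWorld}
    (hle : cleq X Z.val.2 A) (hV : V ∈ sphere X Z) (hA : A ∈ V.val.1) : V = Z := by
  rcases hV with ⟨v1, v2, v3⟩ | hV
  · exact absurd hA (hX.normal_not_mem V.mcs v2 hle v1 v3)
  · exact hV

/-- Limit assumption for the canonical order. -/
theorem exists_min {X : Set Formula} (hX : Mcs X) {A : Formula} {Z : CanonWorld}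
    (hn : condCons X Z.val.2 ⊆ Z.val.1) (hA : A ∈ Z.val.1) :
    ∃ V ∈ sphere X Z, condCons X V.val.2 ⊆ V.val.1 ∧ A ∈ V.val.1 ∧ cleq X V.val.2 A := by
  by_cases hle : cleq X Z.val.2 A
  · exact ⟨Z, Or.inr rfl, hn, hA, hle⟩
  · obtain ⟨Y, hY, hs, hm, hnot⟩ := hX.exists_ext hle
    have hAY : A ∈ Y := (hY.or_iff.1 hm).resolve_left hnot
    refine ⟨⟨(Y, Z.val.2.or A), hY.1, hm⟩, Or.inl ⟨hs, ?_, hnot⟩, hs, hAY, ?_⟩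
    · refine hX.c_mono (hX.c_id _) ?_
      intro v w; simp only [beval_imp, beval_or]; tauto
    · refine hX.c_mono (hX.c_id _) ?_
      intro v w; simp only [beval_imp, beval_or]; tauto

/-- Truth Lemma for the canonical model of PCL. -/
theorem truth_lemma (F : Formula) (w : CanonWorld) :
    F ∈ w.val.1 ↔ Force canonN canonVal F w := by
  induction F generalizing w with
  | atom p => simp [Force, canonVal]
  | bot => simpa [Force] using w.mcs.bot_mem
  | and A B ihA ihB => rw [w.mcs.and_iff, ihA, ihB]; rfl
  | or A B ihA ihB => rw [w.mcs.or_iff, ihA, ihB]; rfl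
  | imp A B ihA ihB => rw [w.mcs.imp_iff, ihA, ihB]; rfl
  | cond A B ihA ihB =>
    simp only [Force, ← ihA, ← ihB]
    have hX := w.mcs
    constructor
    · rintro h α ⟨Y, hY, rfl⟩ ⟨Z, hZ, hAZ⟩
      have hnZ : condCons w.val.1 Z.val.2 ⊆ Z.val.1 := by
        rcases hZ with hZ | hZ
        · exact hZ.1
        · obtain rfl : Z = Y := hZ
          exact hY
      obtain ⟨V, hV, hnV, hAV, hle⟩ := exists_min hX hnZ hAZ
      refine ⟨sphere w.val.1 V, ⟨V, hnV, rfl⟩,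
        (sphere_subset hX hV).trans (sphere_subset hX hZ), ⟨V, Or.inr rfl, hAV⟩, ?_⟩
      intro U hU hAU
      obtain rfl := min_unique hX hle hU hAU
      exact hX.min_sat U.mcs h hle hnV hAU
    · intro h
      by_contra hn
      obtain ⟨Y, hY, hs, hm, hnot⟩ := hX.exists_ext hn
      let y : CanonWorld := ⟨(Y, A), hY.1, hm⟩
      obtain ⟨β, -, hsub, ⟨U, hU, hAU⟩, hall⟩ :=
        h (sphere w.val.1 y) ⟨y, hs, rfl⟩ ⟨y, Or.inr rfl, hm⟩
      have hUy : U = y := by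
        rcases hsub hU with hh | hh
        · exact absurd hAU hh.2.2
        · exact hh
      subst hUy
      exact hnot (hall y hU hm)
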